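/- For every natural number n ≥ 2, the expected comparison count of QuickSort satisfies the recurrence E(t_n) = (n - 1) + (1/n) · ∑_{i=1}^{n} ( E(t_{i-1}) + E(t_{n-i}) ), where E(t_m) = ∑_{x ∈ Q_m} q_m(x) · t_m(x) and E(t_0) = E(t_1) = 0. -/

import Mathlib

/-- Runs of QuickSort, encoded as trees: `node k a b` is a run whose first
splitter has rank `k` (within the current input), with recursive runs `a` on
the `k - 1` smaller elements and `b` on the remaining larger elements. -/
inductive Run : Type where
  | leaf : Run
  | node : ℕ → Run → Run → Run
deriving DecidableEq

/-- The sample space `Q n` of runs of QuickSort on `n` elements: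
`Q 0 = Q 1 = {⊥}` and, for `n ≥ 2`,
`Q n = ⋃_{k ∈ {1,…,n}} {k} × (Q (k-1) × Q (n-k))`. -/
def runs : ℕ → Finset Run
  | 0 => {Run.leaf}
  | 1 => {Run.leaf}
  | n + 2 =>
    (Finset.univ : Finset (Fin (n + 2))).biUnion fun k =>
      ((runs k.val) ×ˢ (runs (n + 1 - k.val))).image fun p =>
        Run.node (k.val + 1) p.1 p.2
decreasing_by
  · exact k.isLt.trans_le (Nat.le_refl _)
  · omega

/-- The probability `q n` of a run of QuickSort on `n` elements:
`q n ⊥ = 1` and `q n (k, (a, b)) = (1 / n) * q (k - 1) a * q (n - k) b`. -/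
noncomputable def qv : ℕ → Run → ℝ
  | _, Run.leaf => 1
  | n, Run.node k a b => (1 / (n : ℝ)) * qv (k - 1) a * qv (n - k) b

/-- The number of comparisons `t n` of a run of QuickSort on `n` elements:
`t n ⊥ = 0` and `t n (k, (a, b)) = (n - 1) + t (k - 1) a + t (n - k) b`. -/
noncomputable def tv : ℕ → Run → ℝ
  | _, Run.leaf => 0
  | n, Run.node k a b => ((n : ℝ) - 1) + tv (k - 1) a + tv (n - k) b

theorem sum_runs_add_two (n : ℕ) (f : Run → ℝ) :
    ∑ x ∈ runs (n + 2), f x = ∑ k ∈ Finset.range (n + 2),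
      ∑ a ∈ runs k, ∑ b ∈ runs (n + 1 - k), f (Run.node (k + 1) a b) := by
  rw [runs, Finset.sum_biUnion]
  · rw [Finset.sum_range]
    refine Finset.sum_congr rfl fun k _ => ?_
    rw [Finset.sum_image, Finset.sum_product]
    rintro ⟨a, b⟩ _ ⟨c, d⟩ _ h
    simpa using h
  · intro k _ l _ hkl
    simp only [Function.onFun, Finset.disjoint_left, Finset.mem_image]
    rintro _ ⟨p, _, rfl⟩ ⟨r, _, h⟩
    injection h with h
    exact hkl (Fin.ext (by omega))

theorem sum_qv (n : ℕ) : ∑ x ∈ runs n, qv n x = 1 := by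
  induction n using Nat.strong_induction_on with
  | _ n ih =>
    match n with
    | 0 => simp [runs, qv]
    | 1 => simp [runs, qv]
    | n + 2 =>
      rw [sum_runs_add_two]
      have h : ∀ k ∈ Finset.range (n + 2), ∑ a ∈ runs k, ∑ b ∈ runs (n + 1 - k),
          qv (n + 2) (Run.node (k + 1) a b) = 1 / ((n + 2 : ℕ) : ℝ) := by
        intro k hk
        simp only [qv, Nat.add_sub_cancel, show n + 2 - (k + 1) = n + 1 - k by omega]
        simp_rw [← Finset.mul_sum]
        rw [ih (n + 1 - k) (by omega)]
        simp_rw [mul_one]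
        rw [← Finset.mul_sum, ih k (Finset.mem_range.mp hk), mul_one]
      rw [Finset.sum_congr rfl h, Finset.sum_const, Finset.card_range, nsmul_eq_mul]
      exact mul_one_div_cancel (by positivity)

/-- Linearity of expectation on the product of two finite probability spaces. -/
theorem sum_sum_mul_add_add {α β : Type*} (s : Finset α) (t : Finset β) (p X : α → ℝ)
    (q Y : β → ℝ) (c d : ℝ) (hp : ∑ a ∈ s, p a = 1) (hq : ∑ b ∈ t, q b = 1) :
    ∑ a ∈ s, ∑ b ∈ t, c * p a * q b * (d + X a + Y b) =
      c * (d + (∑ a ∈ s, p a * X a + ∑ b ∈ t, q b * Y b)) := by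
  have h : ∀ a ∈ s, ∑ b ∈ t, c * p a * q b * (d + X a + Y b) =
      c * (d + ∑ b ∈ t, q b * Y b) * p a + c * (p a * X a) := by
    intro a _
    calc ∑ b ∈ t, c * p a * q b * (d + X a + Y b)
        = ∑ b ∈ t, (c * p a * (d + X a) * q b + c * p a * (q b * Y b)) :=
          Finset.sum_congr rfl fun b _ => by ring
      _ = _ := by
          rw [Finset.sum_add_distrib, ← Finset.mul_sum, ← Finset.mul_sum, hq]
          ring
  rw [Finset.sum_congr rfl h, Finset.sum_add_distrib, ← Finset.mul_sum, ← Finset.mul_sum, hp]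
  ring

/-- For every `n ≥ 2`, the expected comparison count of
QuickSort satisfies the recurrence
`E (t n) = (n - 1) + (1 / n) * ∑_{i = 1}^{n} (E (t (i - 1)) + E (t (n - i)))`,
where `E (t m) = ∑_{x ∈ Q m} q m x * t m x`; moreover `E (t 0) = E (t 1) = 0`. -/
theorem quicksort_expected_comparisons_recurrence :
    (∑ x ∈ runs 0, qv 0 x * tv 0 x) = 0 ∧
    (∑ x ∈ runs 1, qv 1 x * tv 1 x) = 0 ∧
    ∀ n : ℕ, 2 ≤ n →
      (∑ x ∈ runs n, qv n x * tv n x)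
        = ((n : ℝ) - 1) + (1 / (n : ℝ)) *
            ∑ i ∈ Finset.Icc 1 n,
              ((∑ x ∈ runs (i - 1), qv (i - 1) x * tv (i - 1) x) +
               (∑ x ∈ runs (n - i), qv (n - i) x * tv (n - i) x)) := by
  refine ⟨by simp [runs, tv], by simp [runs, tv], fun n hn => ?_⟩
  obtain ⟨n, rfl⟩ := Nat.exists_eq_add_of_le' hn
  rw [sum_runs_add_two, ← Finset.Ico_add_one_right_eq_Icc, Finset.sum_Ico_eq_sum_range]
  have h : ∀ k ∈ Finset.range (n + 2), ∑ a ∈ runs k, ∑ b ∈ runs (n + 1 - k),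
      qv (n + 2) (Run.node (k + 1) a b) * tv (n + 2) (Run.node (k + 1) a b) =
        1 / ((n + 2 : ℕ) : ℝ) * ((((n + 2 : ℕ) : ℝ) - 1) +
          (∑ x ∈ runs k, qv k x * tv k x +
            ∑ x ∈ runs (n + 1 - k), qv (n + 1 - k) x * tv (n + 1 - k) x)) := by
    intro k _
    simp only [qv, tv, Nat.add_sub_cancel, show n + 2 - (k + 1) = n + 1 - k by omega]
    exact sum_sum_mul_add_add _ _ _ _ _ _ _ _ (sum_qv k) (sum_qv _)
  rw [Finset.sum_congr rfl h, ← Finset.mul_sum, Finset.sum_add_distrib, Finset.sum_const,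
    Finset.card_range, nsmul_eq_mul, mul_add, ← mul_assoc,
    one_div_mul_cancel (by positivity), one_mul]
  simp only [Nat.add_sub_cancel, Nat.add_sub_cancel_left,
    show ∀ k, n + 2 - (1 + k) = n + 1 - k by omega]
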